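/- Weighted integration-by-parts inequality in time on the boundary: There exist C > 0 and s0 > 0 such that for every T > 0, every s ≥ s0 T², every ε > 0, and every function g ∈ C^∞([0,T], ℝ), one has ε² s ∫_0^T w0(t) e^{−2 s α0(t)} |g'(t)|² dt ≤ C ( ε² s ∫_0^T w0(t) e^{−2 s α0(t)} |g''(t)| |g(t)| dt + ε² T² s³ ∫_0^T w0(t)⁵ e^{−2 s α0(t)} |g(t)|² dt ), where α0(t) = (e³ − e²)/(t(T−t)) and w0(t) = e²/(t(T−t)). -/

import Mathlib

open Real MeasureTheory intervalIntegral

noncomputable section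

/-- Boundary Carleman weight `α0(t) = (e³ − e²)/(t(T−t))`, i.e. `α(t,0)`. -/
def carlA0 (T t : ℝ) : ℝ := (Real.exp 3 - Real.exp 2) / (t * (T - t))

/-- Boundary Carleman weight `w0(t) = e²/(t(T−t))`, i.e. `w(t,0)`. -/
def carlW0 (T t : ℝ) : ℝ := Real.exp 2 / (t * (T - t))

lemma continuousOn_inv_pow_mul_exp_neg_inv {c : ℝ} (hc : 0 < c) {k : ℕ} (hk : k ≠ 0) :
    ContinuousOn (fun u : ℝ => u⁻¹ ^ k * Real.exp (-c * u⁻¹)) (Set.Ici 0) := by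
  intro u hu
  rcases eq_or_lt_of_le (Set.mem_Ici.mp hu) with rfl | hu
  · rw [← Set.Ioi_insert, continuousWithinAt_insert_self]
    have h := (tendsto_rpow_mul_exp_neg_mul_atTop_nhds_zero (k : ℝ) c hc).comp
      (tendsto_inv_nhdsGT_zero (𝕜 := ℝ))
    simpa [ContinuousWithinAt, Function.comp_def, hk] using h
  · have := hu.ne'
    exact ContinuousAt.continuousWithinAt (by fun_prop (disch := assumption))

lemma continuousOn_carlW0_pow_mul_exp (T : ℝ) {s : ℝ} (hs : 0 < s) {k : ℕ} (hk : k ≠ 0) :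
    ContinuousOn (fun t => carlW0 T t ^ k * Real.exp (-2 * s * carlA0 T t)) (Set.Icc 0 T) := by
  have hK : 0 < Real.exp 3 - Real.exp 2 := sub_pos.2 (Real.exp_lt_exp.2 (by norm_num))
  have hc : 0 < 2 * s * (Real.exp 3 - Real.exp 2) := by positivity
  have h := (continuousOn_inv_pow_mul_exp_neg_inv hc hk).comp
    (f := fun t : ℝ => t * (T - t)) (s := Set.Icc 0 T) (by fun_prop)
    (fun t ht => mul_nonneg ht.1 (sub_nonneg.2 ht.2))
  refine (h.const_mul (Real.exp 2 ^ k)).congr fun t _ => ?_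
  simp only [carlW0, carlA0, Function.comp_apply, div_eq_mul_inv, mul_pow]
  ring_nf

/-- The time derivative of `w0 e^{−2sα0}`, in terms of the powers of `w0`. -/
def carlWeightDeriv (s T t : ℝ) : ℝ :=
  (T - 2 * t) * (2 * s * (Real.exp 3 - Real.exp 2) / Real.exp 2 ^ 2
      * (carlW0 T t ^ 3 * Real.exp (-2 * s * carlA0 T t))
    - 1 / Real.exp 2 * (carlW0 T t ^ 2 * Real.exp (-2 * s * carlA0 T t)))

lemma hasDerivAt_carlW0_mul_exp (s : ℝ) {T t : ℝ} (ht : t * (T - t) ≠ 0) :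
    HasDerivAt (fun t => carlW0 T t * Real.exp (-2 * s * carlA0 T t))
      (carlWeightDeriv s T t) t := by
  have hu : HasDerivAt (fun t : ℝ => t * (T - t)) (T - 2 * t) t := by
    refine ((hasDerivAt_id t).mul ((hasDerivAt_id t).const_sub T)).congr_deriv ?_
    simp only [id]
    ring
  have hw : HasDerivAt (carlW0 T) _ t := (hasDerivAt_const t (Real.exp 2)).div hu ht
  have ha : HasDerivAt (carlA0 T) _ t :=
    (hasDerivAt_const t (Real.exp 3 - Real.exp 2)).div hu ht
  refine (hw.mul (ha.const_mul (-2 * s)).exp).congr_deriv ?_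
  have h2 := (Real.exp_pos 2).ne'
  simp only [carlWeightDeriv]
  generalize Real.exp (-2 * s * carlA0 T t) = E
  simp only [carlW0]
  generalize t * (T - t) = u at ht
  field_simp
  ring

lemma continuousOn_carlWeightDeriv (T : ℝ) {s : ℝ} (hs : 0 < s) :
    ContinuousOn (carlWeightDeriv s T) (Set.Icc 0 T) := by
  have h3 := continuousOn_carlW0_pow_mul_exp T hs (k := 3) (by norm_num)
  have h2 := continuousOn_carlW0_pow_mul_exp T hs (k := 2) (by norm_num)
  exact ContinuousOn.mul (by fun_prop) ((h3.const_mul _).sub (h2.const_mul _))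

lemma abs_carlWeightDeriv_le {s T t : ℝ} (hs : T ^ 2 ≤ s) (ht : t ∈ Set.Ioo 0 T) :
    |carlWeightDeriv s T t| ≤
      3 * T * s * carlW0 T t ^ 2 * (carlW0 T t * Real.exp (-2 * s * carlA0 T t)) := by
  obtain ⟨h0, hT⟩ := ht
  have hu : 0 < t * (T - t) := mul_pos h0 (sub_pos.2 hT)
  have hus : t * (T - t) ≤ s := by nlinarith [sq_nonneg t]
  have hspos : 0 < s := hu.trans_le hus
  have hTpos : 0 < T := h0.trans hT
  have hlt : Real.exp 2 < Real.exp 3 := Real.exp_lt_exp.2 (by norm_num)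
  have hle : Real.exp 3 ≤ Real.exp 2 ^ 2 := by
    rw [← Real.exp_nat_mul]
    exact Real.exp_le_exp.2 (by norm_num)
  have h1 : 1 ≤ Real.exp 2 := Real.one_le_exp (by norm_num)
  have hfactor : carlWeightDeriv s T t =
      (T - 2 * t) * ((2 * s * (Real.exp 3 - Real.exp 2) - t * (T - t)) / (Real.exp 2 ^ 2))
        * (carlW0 T t ^ 2 * (carlW0 T t * Real.exp (-2 * s * carlA0 T t))) := by
    simp only [carlWeightDeriv]
    generalize Real.exp (-2 * s * carlA0 T t) = E
    simp only [carlW0]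
    generalize t * (T - t) = u at hu
    field_simp
  have hw : 0 < carlW0 T t := div_pos (Real.exp_pos 2) hu
  have hP : 0 < carlW0 T t ^ 2 * (carlW0 T t * Real.exp (-2 * s * carlA0 T t)) := by positivity
  have hA : |T - 2 * t| ≤ T := abs_le.2 ⟨by linarith, by linarith⟩
  have hB : |(2 * s * (Real.exp 3 - Real.exp 2) - t * (T - t)) / (Real.exp 2 ^ 2)| ≤ 3 * s := by
    rw [abs_div, abs_of_pos (show 0 < Real.exp 2 ^ 2 by positivity), div_le_iff₀ (by positivity),
      abs_le]
    constructor <;> nlinarith [mul_pos hspos (sub_pos.2 hlt), mul_le_mul_of_nonneg_left hle hspos.le]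
  rw [hfactor, abs_mul, abs_mul, abs_of_pos hP]
  calc _ ≤ T * (3 * s) * _ := by gcongr
    _ = _ := by ring

lemma mul_sq_le_of_abs_deriv_weight_le {r r' M a b c : ℝ} (hr : 0 ≤ r) (hr' : |r'| ≤ M * r) :
    r * b ^ 2 ≤ 2 * (r' * (a * b) + r * (b * b + a * c)) + 2 * (r * |c| * |a|)
      + M ^ 2 * r * a ^ 2 := by
  have h1 : -(r * (a * c)) ≤ r * |c| * |a| := by
    rw [mul_assoc, ← abs_mul, mul_comm c a, ← mul_neg]
    exact mul_le_mul_of_nonneg_left (neg_le_abs _) hr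
  have h2 : -(r' * (a * b)) ≤ M * r * (|a| * |b|) := by
    refine (neg_le_abs _).trans ?_
    rw [abs_mul, abs_mul]
    gcongr
  have h3 : 0 ≤ r * (M * |a| - |b|) ^ 2 := mul_nonneg hr (sq_nonneg _)
  rw [sub_sq, mul_pow, sq_abs, sq_abs] at h3
  linarith

lemma integral_carlWeight_mul_deriv_sq_le {T s : ℝ} (hT : 0 < T) (hs : T ^ 2 ≤ s) {g : ℝ → ℝ}
    (hg : ContDiff ℝ 2 g) :
    (∫ t in (0:ℝ)..T, carlW0 T t * Real.exp (-2 * s * carlA0 T t) * (deriv g t) ^ 2) ≤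
      2 * (∫ t in (0:ℝ)..T, carlW0 T t * Real.exp (-2 * s * carlA0 T t)
          * |deriv (deriv g) t| * |g t|)
        + 9 * T ^ 2 * s ^ 2 * ∫ t in (0:ℝ)..T,
            carlW0 T t ^ 5 * Real.exp (-2 * s * carlA0 T t) * g t ^ 2 := by
  have hspos : 0 < s := (by positivity : (0:ℝ) < T ^ 2).trans_le hs
  have hg' : ContDiff ℝ 1 (deriv g) :=
    ((contDiff_succ_iff_deriv (n := 1)).1 (by simpa [one_add_one_eq_two] using hg)).2.2
  have c0 : Continuous g := hg.continuous
  have c1 : Continuous (deriv g) := hg'.continuous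
  have c2 : Continuous (deriv (deriv g)) := hg'.continuous_deriv le_rfl
  have hρ : ContinuousOn (fun t => carlW0 T t * Real.exp (-2 * s * carlA0 T t))
      (Set.Icc 0 T) := by
    simpa using continuousOn_carlW0_pow_mul_exp T hspos (k := 1) one_ne_zero
  have hρ5 := continuousOn_carlW0_pow_mul_exp T hspos (k := 5) (by norm_num)
  have hρ' := continuousOn_carlWeightDeriv T hspos
  have toInt {f : ℝ → ℝ} (hf : ContinuousOn f (Set.Icc 0 T)) : IntervalIntegrable f volume 0 T :=
    hf.intervalIntegrable_of_Icc hT.le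
  have iL := toInt (hρ.mul (c1.pow 2).continuousOn)
  have iA := toInt ((hρ.mul c2.abs.continuousOn).mul c0.abs.continuousOn)
  have iB := toInt (hρ5.mul (c0.pow 2).continuousOn)
  have iF := toInt ((hρ'.mul (c0.mul c1).continuousOn).add
    (hρ.mul ((c1.mul c1).add (c0.mul c2)).continuousOn))
  have hFTC := integral_eq_sub_of_hasDerivAt_of_le hT.le (hρ.mul (c0.mul c1).continuousOn)
    (fun t ht => (hasDerivAt_carlW0_mul_exp s
        (mul_pos ht.1 (sub_pos.2 ht.2)).ne').mul
      (((hg.differentiable (by norm_num)) t).hasDerivAt.mul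
        ((hg'.differentiable (by norm_num)) t).hasDerivAt)) iF
  have hzero : ∀ t, t * (T - t) = 0 → carlW0 T t = 0 := fun t ht => by simp [carlW0, ht]
  simp only [Pi.mul_apply, hzero T (by ring), hzero 0 (by ring), zero_mul, sub_zero] at hFTC
  have hmono := integral_mono_on_of_le_Ioo hT.le iL
    (((iF.const_mul 2).add (iA.const_mul 2)).add (iB.const_mul (9 * T ^ 2 * s ^ 2)))
    (fun t ht => by
      have hw : 0 < carlW0 T t :=
        div_pos (Real.exp_pos 2) (mul_pos ht.1 (sub_pos.2 ht.2))
      refine (mul_sq_le_of_abs_deriv_weight_le (a := g t) (b := deriv g t)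
        (c := deriv (deriv g) t) (by positivity) (abs_carlWeightDeriv_le hs ht)).trans_eq ?_
      simp only [Pi.mul_apply, Pi.add_apply, Pi.pow_apply]
      ring)
  rw [integral_add ((iF.const_mul 2).add (iA.const_mul 2)) (iB.const_mul _),
    integral_add (iF.const_mul 2) (iA.const_mul 2), intervalIntegral.integral_const_mul,
    intervalIntegral.integral_const_mul, intervalIntegral.integral_const_mul] at hmono
  simp only [Pi.mul_apply, Pi.add_apply, Pi.pow_apply] at hmono hFTC
  rw [hFTC] at hmono
  simpa using hmono

/-- Weighted integration-by-parts inequality in time on the boundary: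
for `s ≳ T²` and smooth `g`,
`ε²s ∫ w0 e^{−2sα0} |g'|² ≤ C (ε²s ∫ w0 e^{−2sα0} |g''||g| + ε²T²s³ ∫ w0⁵ e^{−2sα0} |g|²)`. -/
theorem boundary_time_ibp_inequality :
    ∃ C > (0:ℝ), ∃ s0 > (0:ℝ), ∀ T > (0:ℝ), ∀ s ≥ s0 * T ^ 2, ∀ ε > (0:ℝ),
      ∀ g : ℝ → ℝ, ContDiff ℝ (⊤ : ℕ∞) g →
        ε ^ 2 * s * (∫ t in (0:ℝ)..T,
            carlW0 T t * Real.exp (-2 * s * carlA0 T t) * (deriv g t) ^ 2)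
          ≤ C * (ε ^ 2 * s * (∫ t in (0:ℝ)..T,
                carlW0 T t * Real.exp (-2 * s * carlA0 T t)
                  * |deriv (deriv g) t| * |g t|)
              + ε ^ 2 * T ^ 2 * s ^ 3 * ∫ t in (0:ℝ)..T,
                  carlW0 T t ^ 5 * Real.exp (-2 * s * carlA0 T t) * g t ^ 2) := by
  refine ⟨9, by norm_num, 1, one_pos, fun T hT s hs ε hε g hg => ?_⟩
  rw [ge_iff_le, one_mul] at hs
  have hspos : 0 < s := (by positivity : (0:ℝ) < T ^ 2).trans_le hs
  have h := integral_carlWeight_mul_deriv_sq_le hT hs (contDiff_infty.1 hg 2)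
  have hA : 0 ≤ ∫ t in (0:ℝ)..T, carlW0 T t * Real.exp (-2 * s * carlA0 T t)
      * |deriv (deriv g) t| * |g t| := by
    refine integral_nonneg hT.le fun t ht => ?_
    have hw : 0 ≤ carlW0 T t :=
      div_nonneg (Real.exp_pos 2).le (mul_nonneg ht.1 (sub_nonneg.2 ht.2))
    positivity
  have hc : 0 ≤ ε ^ 2 * s := by positivity
  have h' := mul_le_mul_of_nonneg_left h hc
  have hA' := mul_nonneg hc hA
  linarith
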